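/- Let α, β be scalars in K, let A be a nonassociative K-algebra satisfying α·As(x,y,z) − α·As(y,x,z) + (α+β−3)·As(z,y,x) − β·As(x,z,y) + β·As(y,z,x) + (3−α−β)·As(z,x,y) = 0 for all x,y,z, and let B be a Comm3-algebra. Then the tensor product algebra A⊗B with multiplication (a⊗b)·(a'⊗b') = (a·a')⊗(b·b') satisfies the same identity: α·As(u,v,w) − α·As(v,u,w) + (α+β−3)·As(w,v,u) − β·As(u,w,v) + β·As(v,w,u) + (3−α−β)·As(w,u,v) = 0 for all u,v,w in A⊗B. -/

import Mathlib

open TensorProduct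

/-- The associator of a bilinear multiplication. -/
def As {K : Type*} [Field K] {A : Type*} [AddCommGroup A] [Module K A]
    (μ : A →ₗ[K] A →ₗ[K] A) (x y z : A) : A :=
  μ (μ x y) z - μ x (μ y z)

section

variable {K : Type*} [Field K] {A : Type*} [AddCommGroup A] [Module K A]
  (μ : A →ₗ[K] A →ₗ[K] A)

theorem As_add_left (x x' y z : A) : As μ (x + x') y z = As μ x y z + As μ x' y z := by
  simp only [As, map_add, LinearMap.add_apply]
  abel

theorem As_add_middle (x y y' z : A) : As μ x (y + y') z = As μ x y z + As μ x y' z := by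
  simp only [As, map_add, LinearMap.add_apply]
  abel

theorem As_add_right (x y z z' : A) : As μ x y (z + z') = As μ x y z + As μ x y z' := by
  simp only [As, map_add]
  abel

theorem As_zero_left (y z : A) : As μ 0 y z = 0 := by simp [As]

theorem As_zero_middle (x z : A) : As μ x 0 z = 0 := by simp [As]

theorem As_zero_right (x y : A) : As μ x y 0 = 0 := by simp [As]

theorem As_tmul {B : Type*} [AddCommGroup B] [Module K B] (μB : B →ₗ[K] B →ₗ[K] B)
    (hB : ∀ x y z : B, μB (μB x y) z = μB x (μB y z))
    (ν : TensorProduct K A B →ₗ[K] TensorProduct K A B →ₗ[K] TensorProduct K A B)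
    (hν : ∀ (a a' : A) (b b' : B), ν (a ⊗ₜ[K] b) (a' ⊗ₜ[K] b') = (μ a a') ⊗ₜ[K] (μB b b'))
    (x y z : A) (a b c : B) :
    As ν (x ⊗ₜ[K] a) (y ⊗ₜ[K] b) (z ⊗ₜ[K] c) = As μ x y z ⊗ₜ[K] μB (μB a b) c := by
  simp only [As, hν, TensorProduct.sub_tmul, hB]

end

/-- The tensor product of an algebra satisfying the two-parameter
Lie-admissibility identity with a Comm3-algebra satisfies the same identity. -/
theorem tensor_two_parameter_comm3
    {K : Type*} [Field K] [CharZero K] (α β : K)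
    {A : Type*} [AddCommGroup A] [Module K A]
    {B : Type*} [AddCommGroup B] [Module K B]
    (μA : A →ₗ[K] A →ₗ[K] A) (μB : B →ₗ[K] B →ₗ[K] B)
    (hA : ∀ x y z : A,
      α • As μA x y z - α • As μA y x z + (α + β - 3) • As μA z y x
        - β • As μA x z y + β • As μA y z x + (3 - α - β) • As μA z x y = 0)
    (hBassoc : ∀ x y z : B, μB (μB x y) z = μB x (μB y z))
    (hBswap12 : ∀ x y z : B, μB (μB x y) z = μB (μB y x) z)
    (hBswap23 : ∀ x y z : B, μB (μB x y) z = μB (μB x z) y)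
    (μ : TensorProduct K A B →ₗ[K] TensorProduct K A B →ₗ[K] TensorProduct K A B)
    (hμ : ∀ (a a' : A) (b b' : B),
      μ (a ⊗ₜ[K] b) (a' ⊗ₜ[K] b') = (μA a a') ⊗ₜ[K] (μB b b')) :
    ∀ u v w : TensorProduct K A B,
      α • As μ u v w - α • As μ v u w + (α + β - 3) • As μ w v u
        - β • As μ u w v + β • As μ v w u + (3 - α - β) • As μ w u v = 0 := by
  intro u v w
  induction u using TensorProduct.induction_on with
  | zero => simp [As_zero_left, As_zero_middle, As_zero_right]
  | add u u' hu hu' =>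
    simp only [As_add_left, As_add_middle, As_add_right]
    linear_combination (norm := module) hu + hu'
  | tmul x a =>
  induction v using TensorProduct.induction_on with
  | zero => simp [As_zero_left, As_zero_middle, As_zero_right]
  | add v v' hv hv' =>
    simp only [As_add_left, As_add_middle, As_add_right]
    linear_combination (norm := module) hv + hv'
  | tmul y b =>
  induction w using TensorProduct.induction_on with
  | zero => simp [As_zero_left, As_zero_middle, As_zero_right]
  | add w w' hw hw' =>
    simp only [As_add_left, As_add_middle, As_add_right]
    linear_combination (norm := module) hw + hw'
  | tmul z c =>
    have hbac : μB (μB b a) c = μB (μB a b) c := hBswap12 b a c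
    have hacb : μB (μB a c) b = μB (μB a b) c := hBswap23 a c b
    have hbca : μB (μB b c) a = μB (μB a b) c := (hBswap23 b c a).trans hbac
    have hcab : μB (μB c a) b = μB (μB a b) c := (hBswap12 c a b).trans hacb
    have hcba : μB (μB c b) a = μB (μB a b) c := (hBswap12 c b a).trans hbca
    simp only [As_tmul μA μB hBassoc μ hμ, hbac, hacb, hbca, hcab, hcba,
      TensorProduct.smul_tmul', ← TensorProduct.sub_tmul, ← TensorProduct.add_tmul, hA,
      TensorProduct.zero_tmul]
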